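/- Let M, Λ₁ and Λ₂ be vector spaces over ℚ, let e₁ and e₂ be nonzero rational numbers, and for i = 1, 2 let Φᵢ : M → Λᵢ and Ψᵢ : Λᵢ → M be linear maps such that Ψᵢ ∘ Φᵢ = −(2eᵢ) • id_M and Ψᵢ is surjective. Define σᵢ := id + Φᵢ ∘ Ψᵢ, Pᵢ := Im(σᵢ − id) ⊆ Λᵢ, and γ₁₂ := Φ₂ ∘ Ψ₁ : Λ₁ → Λ₂. Then: (a) the range of γ₁₂ is contained in P₂; and (b) there exists a linear isomorphism t₁₂ : P₁ → P₂ such that t₁₂(Φ₁ α) = Φ₂ α for all α ∈ M and γ₁₂(x) = t₁₂((σ₁ − id)x) for all x ∈ Λ₁. -/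

import Mathlib

/-- A linear map with a left inverse up to a nonzero scalar is injective. -/
theorem injective_of_comp_eq_neg_smul_id {K M N : Type*} [Field K] [AddCommGroup M] [Module K M]
    [AddCommGroup N] [Module K N] {c : K} (hc : c ≠ 0) {Φ : M →ₗ[K] N} {Ψ : N →ₗ[K] M}
    (h : Ψ ∘ₗ Φ = -c • (LinearMap.id : M →ₗ[K] M)) : Function.Injective Φ := by
  refine (injective_iff_map_eq_zero Φ).2 fun a ha => ?_
  have := LinearMap.congr_fun h a
  simpa [ha, hc] using this.symm


/-- Two Prym–Tjurin presentations of the same `M`: the incidence map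
`γ₁₂ := Φ₂ ∘ Ψ₁` lands in `P₂` and factors as `t₁₂ ∘ (σ₁ - id)` for an isomorphism
`t₁₂ : P₁ ≃ P₂` with `t₁₂ ∘ Φ₁ = Φ₂`. -/
theorem stmt12 (M Λ₁ Λ₂ : Type*) [AddCommGroup M] [Module ℚ M]
    [AddCommGroup Λ₁] [Module ℚ Λ₁] [AddCommGroup Λ₂] [Module ℚ Λ₂]
    (e₁ e₂ : ℚ) (he₁ : e₁ ≠ 0) (he₂ : e₂ ≠ 0)
    (Φ₁ : M →ₗ[ℚ] Λ₁) (Ψ₁ : Λ₁ →ₗ[ℚ] M)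
    (Φ₂ : M →ₗ[ℚ] Λ₂) (Ψ₂ : Λ₂ →ₗ[ℚ] M)
    (h₁ : Ψ₁ ∘ₗ Φ₁ = -(2 * e₁) • (LinearMap.id : M →ₗ[ℚ] M))
    (h₂ : Ψ₂ ∘ₗ Φ₂ = -(2 * e₂) • (LinearMap.id : M →ₗ[ℚ] M))
    (hΨ₁ : Function.Surjective Ψ₁) (hΨ₂ : Function.Surjective Ψ₂)
    (σ₁ : Λ₁ →ₗ[ℚ] Λ₁) (hσ₁ : σ₁ = LinearMap.id + Φ₁ ∘ₗ Ψ₁)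
    (σ₂ : Λ₂ →ₗ[ℚ] Λ₂) (hσ₂ : σ₂ = LinearMap.id + Φ₂ ∘ₗ Ψ₂)
    (P₁ : Submodule ℚ Λ₁) (hP₁ : P₁ = LinearMap.range (σ₁ - LinearMap.id))
    (P₂ : Submodule ℚ Λ₂) (hP₂ : P₂ = LinearMap.range (σ₂ - LinearMap.id))
    (γ₁₂ : Λ₁ →ₗ[ℚ] Λ₂) (hγ : γ₁₂ = Φ₂ ∘ₗ Ψ₁) :
    LinearMap.range γ₁₂ ≤ P₂ ∧
      ∃ t₁₂ : P₁ ≃ₗ[ℚ] P₂,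
        (∀ (α : M) (hα : Φ₁ α ∈ P₁), (t₁₂ ⟨Φ₁ α, hα⟩ : Λ₂) = Φ₂ α) ∧
        (∀ (x : Λ₁) (hx : (σ₁ - (LinearMap.id : Λ₁ →ₗ[ℚ] Λ₁)) x ∈ P₁),
          (t₁₂ ⟨(σ₁ - (LinearMap.id : Λ₁ →ₗ[ℚ] Λ₁)) x, hx⟩ : Λ₂) = γ₁₂ x) := by
  have hi₁ : Function.Injective Φ₁ :=
    injective_of_comp_eq_neg_smul_id (mul_ne_zero two_ne_zero he₁) h₁
  have hi₂ : Function.Injective Φ₂ :=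
    injective_of_comp_eq_neg_smul_id (mul_ne_zero two_ne_zero he₂) h₂
  have hd : σ₁ - LinearMap.id = Φ₁ ∘ₗ Ψ₁ := by rw [hσ₁, add_sub_cancel_left]
  have hP₁' : P₁ = LinearMap.range Φ₁ := by
    rw [hP₁, hd, LinearMap.range_comp_of_range_eq_top _ (LinearMap.range_eq_top.2 hΨ₁)]
  have hP₂' : P₂ = LinearMap.range Φ₂ := by
    rw [hP₂, hσ₂, add_sub_cancel_left,
      LinearMap.range_comp_of_range_eq_top _ (LinearMap.range_eq_top.2 hΨ₂)]
  clear hP₁ hP₂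
  subst hP₁' hP₂' hγ
  have key (α : M) (hα : Φ₁ α ∈ LinearMap.range Φ₁) :
      (((LinearEquiv.ofInjective Φ₁ hi₁).symm.trans (LinearEquiv.ofInjective Φ₂ hi₂))
        ⟨Φ₁ α, hα⟩ : Λ₂) = Φ₂ α := by
    have : (LinearEquiv.ofInjective Φ₁ hi₁).symm ⟨Φ₁ α, hα⟩ = α :=
      (LinearEquiv.symm_apply_eq _).2 rfl
    rw [LinearEquiv.trans_apply, this, LinearEquiv.ofInjective_apply]
  refine ⟨LinearMap.range_comp_le_range _ _,
    (LinearEquiv.ofInjective Φ₁ hi₁).symm.trans (LinearEquiv.ofInjective Φ₂ hi₂), key, ?_⟩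
  rw [hd]
  exact fun x hx => key (Ψ₁ x) hx
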